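/- Let X and X' be n×m random matrices with mean-zero entries having finite absolute third moments. For every β > 0, δ > 0, τ > 1/(β(1+δ)), setting λ = (log n)/(βδ) ∨ (log m)/β, for every Borel subset A of ℝ one has P(min_{1≤i≤n} max_{1≤j≤m} X_{i,j} ∈ A) ≤ P(min_{1≤i≤n} max_{1≤j≤m} X'_{i,j} ∈ A^{2λ+3τ}) + (ε + C β(1+δ) τ⁻¹ (B₁ + B₁' + B₃ + β(1+δ)(B₂ + B₂')))/(1 − ε), where C > 0 is a universal constant and A^{r} = {x ∈ ℝ : dist(x, A) ≤ r} denotes the r-enlargement of A. -/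

import Mathlib

open MeasureTheory ProbabilityTheory Real

/-- The log-sum-exp function of a finite family. -/
noncomputable def logSumExp {ι : Type*} [Fintype ι] (v : ι → ℝ) : ℝ :=
  log (∑ i, exp (v i))

/-- The average of `w` with respect to the softmax weights of `v`. -/
noncomputable def softAvg {ι : Type*} [Fintype ι] (v w : ι → ℝ) : ℝ :=
  (∑ i, exp (v i) * w i) / ∑ i, exp (v i)

section Softmax

variable {ι : Type*} [Fintype ι]

lemma sum_exp_pos [Nonempty ι] (v : ι → ℝ) : 0 < ∑ i, exp (v i) :=
  Finset.sum_pos (fun _ _ => exp_pos _) Finset.univ_nonempty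

lemma abs_softAvg_le [Nonempty ι] (v : ι → ℝ) {w : ι → ℝ} {c : ℝ} (h : ∀ i, |w i| ≤ c) :
    |softAvg v w| ≤ c := by
  have hS := sum_exp_pos v
  rw [softAvg, abs_div, abs_of_pos hS, div_le_iff₀ hS, Finset.mul_sum]
  refine (Finset.abs_sum_le_sum_abs _ _).trans (Finset.sum_le_sum fun i _ => ?_)
  rw [abs_mul, abs_of_pos (exp_pos _), mul_comm c]
  exact mul_le_mul_of_nonneg_left (h i) (exp_pos _).le

lemma softAvg_const_left (c : ℝ) (w : ι → ℝ) : softAvg (fun _ => c) w = softAvg 0 w := by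
  simp only [softAvg, Pi.zero_apply, exp_zero, one_mul, ← Finset.mul_sum, Finset.sum_const,
    nsmul_eq_mul]
  have hc := exp_ne_zero c
  by_cases h : Fintype.card ι = 0
  · simp [h]
  · have : ((Finset.univ : Finset ι).card : ℝ) ≠ 0 := by
      simpa [Finset.card_univ] using h
    field_simp

lemma softAvg_mul_right (v w : ι → ℝ) (c : ℝ) :
    softAvg v (fun i => w i * c) = softAvg v w * c := by
  simp only [softAvg, ← mul_assoc, ← Finset.sum_mul]
  ring

lemma softAvg_mul_left (v w : ι → ℝ) (c : ℝ) :
    softAvg v (fun i => c * w i) = c * softAvg v w := by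
  simp only [mul_comm c, softAvg_mul_right]

lemma softAvg_sub (v w z : ι → ℝ) :
    softAvg v (fun i => w i - z i) = softAvg v w - softAvg v z := by
  simp only [softAvg, mul_sub, Finset.sum_sub_distrib, sub_div]

lemma integrable_softAvg {Ω : Type*} [MeasurableSpace Ω] {P : Measure Ω} (v : ι → ℝ)
    {w : Ω → ι → ℝ} (h : ∀ i, Integrable (fun ω => w ω i) P) :
    Integrable (fun ω => softAvg v (w ω)) P :=
  (integrable_finsetSum _ fun i _ => (h i).const_mul _).div_const _

lemma integral_softAvg {Ω : Type*} [MeasurableSpace Ω] {P : Measure Ω} (v : ι → ℝ)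
    {w : Ω → ι → ℝ} (h : ∀ i, Integrable (fun ω => w ω i) P) :
    ∫ ω, softAvg v (w ω) ∂P = softAvg v (fun i => ∫ ω, w ω i ∂P) := by
  simp only [softAvg]
  rw [integral_div, integral_finsetSum _ fun i _ => (h i).const_mul _]
  simp only [integral_const_mul]

lemma hasDerivAt_softAvg [Nonempty ι] {v w : ι → ℝ → ℝ} {v' w' : ι → ℝ} {t : ℝ}
    (hv : ∀ i, HasDerivAt (v i) (v' i) t) (hw : ∀ i, HasDerivAt (w i) (w' i) t) :
    HasDerivAt (fun s => softAvg (fun i => v i s) (fun i => w i s))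
      (softAvg (fun i => v i t) w' + softAvg (fun i => v i t) (fun i => w i t * v' i)
        - softAvg (fun i => v i t) (fun i => w i t) * softAvg (fun i => v i t) v') t := by
  have hS := (sum_exp_pos fun i => v i t).ne'
  have h1 := HasDerivAt.fun_sum (u := Finset.univ) fun i _ => (hv i).exp.mul (hw i)
  have h2 := HasDerivAt.fun_sum (u := Finset.univ) fun i _ => (hv i).exp
  refine (h1.div h2 hS).congr_deriv ?_
  simp only [softAvg, Finset.sum_add_distrib]
  have h3 : ∑ i, exp (v i t) * v' i * w i t = ∑ i, exp (v i t) * (w i t * v' i) :=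
    Finset.sum_congr rfl fun i _ => by ring
  simp only [Pi.mul_apply]
  rw [h3]
  field_simp
  ring

lemma hasDerivAt_logSumExp [Nonempty ι] {v : ι → ℝ → ℝ} {v' : ι → ℝ} {t : ℝ}
    (hv : ∀ i, HasDerivAt (v i) (v' i) t) :
    HasDerivAt (fun s => logSumExp fun i => v i s) (softAvg (fun i => v i t) v') t := by
  have h2 := HasDerivAt.fun_sum (u := Finset.univ) fun i _ => (hv i).exp
  exact h2.log (sum_exp_pos fun i => v i t).ne'

lemma le_logSumExp [Nonempty ι] (v : ι → ℝ) (i : ι) : v i ≤ logSumExp v := by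
  rw [logSumExp, le_log_iff_exp_le (sum_exp_pos v)]
  exact Finset.single_le_sum (f := fun i => exp (v i)) (fun j _ => (exp_pos _).le)
    (Finset.mem_univ i)

lemma logSumExp_le [Nonempty ι] {v : ι → ℝ} {c : ℝ} (h : ∀ i, v i ≤ c) :
    logSumExp v ≤ log (Fintype.card ι) + c := by
  have hcard : (0 : ℝ) < Fintype.card ι := by exact_mod_cast Fintype.card_pos
  rw [logSumExp, log_le_iff_le_exp (sum_exp_pos v), exp_add, exp_log hcard]
  calc ∑ i, exp (v i) ≤ ∑ _i : ι, exp c := Finset.sum_le_sum fun i _ => exp_le_exp.2 (h i)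
    _ = _ := by simp

end Softmax

/-- `f` has successive derivatives `f₁`, `f₂` and a third derivative, bounded respectively
by `a₁`, `a₂` and `a₃`. -/
structure BoundedJet (f f₁ f₂ : ℝ → ℝ) (a₁ a₂ a₃ : ℝ) : Prop where
  hasDerivAt : ∀ t, HasDerivAt f (f₁ t) t
  hasDerivAt_first : ∀ t, HasDerivAt f₁ (f₂ t) t
  third : ∀ t, ∃ c, HasDerivAt f₂ c t ∧ |c| ≤ a₃
  first_le : ∀ t, |f₁ t| ≤ a₁
  second_le : ∀ t, |f₂ t| ≤ a₂

namespace BoundedJet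

lemma const_mul {f f₁ f₂ : ℝ → ℝ} {a₁ a₂ a₃ : ℝ} (h : BoundedJet f f₁ f₂ a₁ a₂ a₃) (c : ℝ) :
    BoundedJet (fun t => c * f t) (fun t => c * f₁ t) (fun t => c * f₂ t)
      (|c| * a₁) (|c| * a₂) (|c| * a₃) where
  hasDerivAt t := (h.hasDerivAt t).const_mul c
  hasDerivAt_first t := (h.hasDerivAt_first t).const_mul c
  third t := by
    obtain ⟨d, hd, hda⟩ := h.third t
    exact ⟨c * d, hd.const_mul c, by rw [abs_mul]; gcongr⟩
  first_le t := by rw [abs_mul]; have := h.first_le t; gcongr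
  second_le t := by rw [abs_mul]; have := h.second_le t; gcongr

lemma comp {f f₁ f₂ g g₁ g₂ : ℝ → ℝ} {a₁ a₂ a₃ b₁ b₂ b₃ : ℝ}
    (hg : BoundedJet g g₁ g₂ b₁ b₂ b₃) (hf : BoundedJet f f₁ f₂ a₁ a₂ a₃) :
    BoundedJet (fun t => g (f t)) (fun t => g₁ (f t) * f₁ t)
      (fun t => g₂ (f t) * f₁ t ^ 2 + g₁ (f t) * f₂ t)
      (b₁ * a₁) (b₂ * a₁ ^ 2 + b₁ * a₂) (b₃ * a₁ ^ 3 + 3 * (b₂ * a₁ * a₂) + b₁ * a₃) := by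
  have ha₁ := (abs_nonneg _).trans (hf.first_le 0)
  have hb₁ := (abs_nonneg _).trans (hg.first_le 0)
  have hb₂ := (abs_nonneg _).trans (hg.second_le 0)
  have hc := fun t => (hg.hasDerivAt (f t)).comp t (hf.hasDerivAt t)
  have hc₁ := fun t => (hg.hasDerivAt_first (f t)).comp t (hf.hasDerivAt t)
  refine ⟨hc, fun t => ?_, fun t => ?_, fun t => ?_, fun t => ?_⟩
  · exact ((hc₁ t).mul (hf.hasDerivAt_first t)).congr_deriv (by simp; ring)
  · obtain ⟨d, hd, hda⟩ := hf.third t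
    obtain ⟨e, he, hea⟩ := hg.third (f t)
    have hb₃ := (abs_nonneg _).trans hea
    refine ⟨e * f₁ t ^ 3 + 3 * (g₂ (f t) * f₁ t * f₂ t) + g₁ (f t) * d, ?_, ?_⟩
    · have h := ((he.comp t (hf.hasDerivAt t)).mul ((hf.hasDerivAt_first t).pow 2)).add
        ((hc₁ t).mul hd)
      exact h.congr_deriv (by simp; ring)
    · refine (abs_add_three _ _ _).trans ?_
      simp only [abs_mul, abs_pow, abs_of_pos (three_pos : (0 : ℝ) < 3)]
      have := hf.first_le t
      have := hf.second_le t
      have := hg.first_le (f t)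
      have := hg.second_le (f t)
      gcongr
  · rw [abs_mul]
    have := hf.first_le t
    have := hg.first_le (f t)
    gcongr
  · refine (abs_add_le _ _).trans ?_
    simp only [abs_mul, abs_pow]
    have := hf.first_le t
    have := hf.second_le t
    have := hg.first_le (f t)
    have := hg.second_le (f t)
    gcongr

lemma logSumExp_comp {ι : Type*} [Fintype ι] [Nonempty ι] {v v₁ v₂ : ι → ℝ → ℝ} {a₁ a₂ a₃ : ℝ}
    (h : ∀ i, BoundedJet (v i) (v₁ i) (v₂ i) a₁ a₂ a₃) :
    BoundedJet (fun t => logSumExp fun i => v i t)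
      (fun t => softAvg (fun i => v i t) fun i => v₁ i t)
      (fun t => softAvg (fun i => v i t) (fun i => v₂ i t)
        + softAvg (fun i => v i t) (fun i => v₁ i t * v₁ i t)
        - softAvg (fun i => v i t) (fun i => v₁ i t)
          * softAvg (fun i => v i t) (fun i => v₁ i t))
      a₁ (a₂ + 2 * a₁ ^ 2) (a₃ + 6 * (a₁ * a₂) + 6 * a₁ ^ 3) := by
  have i₀ : ι := Classical.arbitrary ι
  have ha₁ := (abs_nonneg _).trans ((h i₀).first_le 0)
  have ha₂ := (abs_nonneg _).trans ((h i₀).second_le 0)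
  have hb₁ : ∀ t, |softAvg (fun i => v i t) fun i => v₁ i t| ≤ a₁ := fun t =>
    abs_softAvg_le _ fun i => (h i).first_le t
  have hb₂ : ∀ t, |softAvg (fun i => v i t) fun i => v₂ i t| ≤ a₂ := fun t =>
    abs_softAvg_le _ fun i => (h i).second_le t
  have hb₁₁ : ∀ t, |softAvg (fun i => v i t) fun i => v₁ i t * v₁ i t| ≤ a₁ * a₁ := fun t =>
    abs_softAvg_le _ fun i => by
      rw [abs_mul]; have := (h i).first_le t; gcongr
  have hmul : ∀ {p q A B : ℝ}, |p| ≤ A → |q| ≤ B → |p * q| ≤ A * B := fun {p q A B} hp hq => by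
    rw [abs_mul]; exact mul_le_mul hp hq (abs_nonneg _) ((abs_nonneg _).trans hp)
  have hsec : ∀ t, |softAvg (fun i => v i t) (fun i => v₂ i t)
        + softAvg (fun i => v i t) (fun i => v₁ i t * v₁ i t)
        - softAvg (fun i => v i t) (fun i => v₁ i t)
          * softAvg (fun i => v i t) (fun i => v₁ i t)| ≤ a₂ + 2 * a₁ ^ 2 := fun t => by
    have h1 := abs_le.1 (hb₂ t)
    have h2 := abs_le.1 (hb₁₁ t)
    have h3 := abs_le.1 (hmul (hb₁ t) (hb₁ t))
    rw [abs_le]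
    constructor <;> nlinarith
  have hd₁ := fun t => hasDerivAt_softAvg (fun i => (h i).hasDerivAt t)
    fun i => (h i).hasDerivAt_first t
  refine ⟨fun t => hasDerivAt_logSumExp fun i => (h i).hasDerivAt t, hd₁, fun t => ?_, hb₁, hsec⟩
  choose c hc hca using fun i => (h i).third t
  have hd₂ := hasDerivAt_softAvg (fun i => (h i).hasDerivAt t) hc
  have hd₁₁ := hasDerivAt_softAvg (fun i => (h i).hasDerivAt t)
    fun i => ((h i).hasDerivAt_first t).mul ((h i).hasDerivAt_first t)
  refine ⟨_, (hd₂.add hd₁₁).sub ((hd₁ t).mul (hd₁ t)), ?_⟩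
  simp only [Pi.mul_apply]
  have e1 := abs_le.1 (abs_softAvg_le (fun i => v i t) hca)
  have e2 := abs_le.1 (abs_softAvg_le (fun i => v i t) fun i =>
    hmul ((h i).second_le t) ((h i).first_le t))
  have e3 := abs_le.1 (hmul (hb₂ t) (hb₁ t))
  have e4 : ∀ i, |v₂ i t * v₁ i t + v₁ i t * v₂ i t| ≤ a₂ * a₁ + a₁ * a₂ := fun i =>
    (abs_add_le _ _).trans (add_le_add (hmul ((h i).second_le t) ((h i).first_le t))
      (hmul ((h i).first_le t) ((h i).second_le t)))
  have e4 := abs_le.1 (abs_softAvg_le (fun i => v i t) e4)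
  have e5 := abs_le.1 (abs_softAvg_le (fun i => v i t) fun i =>
    hmul (hmul ((h i).first_le t) ((h i).first_le t)) ((h i).first_le t))
  have e6 := abs_le.1 (hmul (hb₁₁ t) (hb₁ t))
  have e7 := abs_le.1 (hmul (hsec t) (hb₁ t))
  have e8 := abs_le.1 (hmul (hb₁ t) (hsec t))
  rw [abs_le]
  constructor <;> nlinarith

lemma continuous {f f₁ f₂ : ℝ → ℝ} {a₁ a₂ a₃ : ℝ}
    (h : BoundedJet f f₁ f₂ a₁ a₂ a₃) : Continuous f :=
  continuous_iff_continuousAt.2 fun t => (h.hasDerivAt t).continuousAt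

/-- Second-order Taylor estimate at `0` for a function on the line. -/
lemma abs_taylor_le {f f₁ f₂ : ℝ → ℝ} {a₁ a₂ a₃ : ℝ} (h : BoundedJet f f₁ f₂ a₁ a₂ a₃) :
    |f 1 - f 0 - f₁ 0 - f₂ 0 / 2| ≤ a₃ := by
  have ha₃ : 0 ≤ a₃ := (h.third 0).elim fun c hc => (abs_nonneg c).trans hc.2
  choose c hc hca using h.third
  have h2 : ∀ t ∈ Set.Icc (0 : ℝ) 1, |f₂ t - f₂ 0| ≤ a₃ := fun t ht => by
    have := norm_image_sub_le_of_norm_deriv_le_segment' (f := f₂) (f' := c) (C := a₃)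
      (a := 0) (b := 1) (fun x _ => (hc x).hasDerivWithinAt) (fun x _ => hca x) t ht
    rw [Real.norm_eq_abs] at this
    exact this.trans (by nlinarith [ht.1, ht.2])
  have h1 : ∀ t ∈ Set.Icc (0 : ℝ) 1, |f₁ t - t * f₂ 0 - f₁ 0| ≤ a₃ := fun t ht => by
    have := norm_image_sub_le_of_norm_deriv_le_segment' (f := fun t => f₁ t - t * f₂ 0)
      (f' := fun t => f₂ t - f₂ 0) (C := a₃) (a := 0) (b := 1)
      (fun x _ => ((h.hasDerivAt_first x).sub
        ((hasDerivAt_id x).mul_const (f₂ 0))).hasDerivWithinAt.congr_deriv (by simp))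
      (fun x hx => h2 x (Set.Ico_subset_Icc_self hx)) t ht
    rw [Real.norm_eq_abs] at this
    simp only [zero_mul, sub_zero] at this
    exact this.trans (by nlinarith [ht.1, ht.2])
  have := norm_image_sub_le_of_norm_deriv_le_segment_01'
    (f := fun t => f t - t * f₁ 0 - t ^ 2 / 2 * f₂ 0)
    (f' := fun t => f₁ t - t * f₂ 0 - f₁ 0) (C := a₃)
    (fun x _ => (((h.hasDerivAt x).sub ((hasDerivAt_id x).mul_const (f₁ 0))).sub
      ((((hasDerivAt_id x).pow 2).div_const 2).mul_const (f₂ 0))).hasDerivWithinAt.congr_deriv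
        (by simp; ring))
    (fun x hx => h1 x (Set.Ico_subset_Icc_self hx))
  rw [Real.norm_eq_abs] at this
  convert this using 2
  ring

end BoundedJet

/-- Smoothed indicator functions on the line, with derivatives bounded uniformly in the set. -/
lemma exists_smooth_indicator :
    ∃ C : ℝ, 0 < C ∧ ∀ B : Set ℝ, MeasurableSet B → ∃ g g₁ g₂ : ℝ → ℝ,
      BoundedJet g g₁ g₂ C C C ∧ (∀ x, 0 ≤ g x) ∧ (∀ x, g x ≤ 1) ∧
      (∀ x, (∀ t, |x - t| ≤ 1 → t ∈ B) → g x = 1) ∧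
      (∀ x, (∀ t, |x - t| ≤ 1 → t ∉ B) → g x = 0) := by
  let φ : ContDiffBump (0 : ℝ) := ⟨1 / 2, 1, by norm_num, by norm_num⟩
  let k : ℕ → ℝ → ℝ := fun r => deriv^[r] (φ.normed volume)
  have hk_smooth : ∀ r, ContDiff ℝ 1 (k r) := fun r =>
    (ContDiff.iterate_deriv' 1 r (φ.contDiff_normed))
  have hk_supp : ∀ r, HasCompactSupport (k r) := fun r => by
    induction r with
    | zero => exact φ.hasCompactSupport_normed
    | succ r ih =>
      simp only [k, Function.iterate_succ', Function.comp] at ih ⊢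
      exact ih.deriv
  have hk_int : ∀ r, Integrable (k r) := fun r =>
    (hk_smooth r).continuous.integrable_of_hasCompactSupport (hk_supp r)
  let c : ℕ → ℝ := fun r => ∫ x, |k r x|
  have hc : ∀ r, 0 ≤ c r := fun r => integral_nonneg fun x => abs_nonneg _
  refine ⟨c 1 + c 2 + c 3 + 1, by linarith [hc 1, hc 2, hc 3], fun B hB => ?_⟩
  let f : ℝ → ℝ := B.indicator 1
  have hf01 : ∀ x, 0 ≤ f x ∧ f x ≤ 1 := fun x => by
    by_cases hx : x ∈ B <;> simp [f, hx]
  have hf_meas : Measurable f := measurable_one.indicator hB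
  have hf_loc : LocallyIntegrable f := by
    refine (locallyIntegrable_const (1 : ℝ)).mono hf_meas.aestronglyMeasurable
      (Filter.Eventually.of_forall fun x => ?_)
    rw [Real.norm_eq_abs, abs_of_nonneg (hf01 x).1]
    simpa using (hf01 x).2
  let G : ℕ → ℝ → ℝ := fun r => convolution f (k r) (ContinuousLinearMap.mul ℝ ℝ) volume
  have hG : ∀ r x, G r x = ∫ t, f t * k r (x - t) := fun r x => by
    simp [G, convolution_def]
  have hG_deriv : ∀ r x, HasDerivAt (G r) (G (r + 1) x) x := fun r x => by
    have := (hk_supp r).hasDerivAt_convolution_right (ContinuousLinearMap.mul ℝ ℝ) hf_loc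
      (hk_smooth r) x
    simpa only [G, k, Function.iterate_succ', Function.comp] using this
  have hk_shift : ∀ r x, Integrable fun t => k r (x - t) := fun r x => (hk_int r).comp_sub_left x
  have hG_le : ∀ r x, |G r x| ≤ c r := fun r x => by
    rw [hG, ← Real.norm_eq_abs]
    refine (norm_integral_le_of_norm_le (hk_shift r x).norm
      (Filter.Eventually.of_forall fun t => ?_)).trans_eq ?_
    · rw [norm_mul, Real.norm_eq_abs (f t), abs_of_nonneg (hf01 t).1]
      exact mul_le_of_le_one_left (norm_nonneg _) (hf01 t).2
    · exact integral_sub_left_eq_self (fun t => ‖k r t‖) volume x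
  have hk0 : ∀ x, 0 ≤ k 0 x := fun x => φ.nonneg_normed x
  have hk0_zero : ∀ x, 1 < |x| → k 0 x = 0 := fun x hx => by
    have : x ∉ Function.support (φ.normed volume) := by
      rw [φ.support_normed_eq]
      simp only [Metric.mem_ball, dist_zero_right, Real.norm_eq_abs, not_lt, φ]
      exact hx.le
    simpa [k] using this
  have hk0_int : ∀ x, ∫ t, k 0 (x - t) = 1 := fun x =>
    (integral_sub_left_eq_self (k 0) volume x).trans φ.integral_normed
  refine ⟨G 0, G 1, G 2, ⟨hG_deriv 0, hG_deriv 1, fun t => ⟨_, hG_deriv 2 t, ?_⟩,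
    fun t => ?_, fun t => ?_⟩, fun x => ?_, fun x => ?_, fun x hx => ?_, fun x hx => ?_⟩
  · linarith [hG_le 3 t, hc 1, hc 2]
  · linarith [hG_le 1 t, hc 2, hc 3]
  · linarith [hG_le 2 t, hc 1, hc 3]
  · rw [hG]
    exact integral_nonneg fun t => mul_nonneg (hf01 t).1 (hk0 _)
  · rw [hG, ← hk0_int x]
    exact integral_mono_of_nonneg
      (Filter.Eventually.of_forall fun t => mul_nonneg (hf01 t).1 (hk0 _)) (hk_shift 0 x)
      (Filter.Eventually.of_forall fun t => mul_le_of_le_one_left (hk0 _) (hf01 t).2)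
  · rw [hG, ← hk0_int x]
    refine integral_congr_ae (Filter.Eventually.of_forall fun t => ?_)
    rcases le_or_gt |x - t| 1 with h | h
    · simp [f, hx t h]
    · simp [hk0_zero _ h]
  · rw [hG, ← integral_zero ℝ ℝ]
    refine integral_congr_ae (Filter.Eventually.of_forall fun t => ?_)
    rcases le_or_gt |x - t| 1 with h | h
    · simp [f, hx t h]
    · simp [hk0_zero _ h]

section SmoothMinMax

variable {ι κ : Type*} [Fintype ι] [Fintype κ]

/-- Smooth approximation of `⨅ i, ⨆ j, x i j`. -/
noncomputable def smoothMinMax {ι κ : Type*} [Fintype ι] [Fintype κ] (β δ : ℝ)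
    (x : ι → κ → ℝ) : ℝ :=
  -(β * δ)⁻¹ * logSumExp fun i => -δ * logSumExp fun j => β * x i j

lemma abs_smoothMinMax_sub_le [Nonempty ι] [Nonempty κ]
    {β δ : ℝ} (hβ : 0 < β) (hδ : 0 < δ) (x : ι → κ → ℝ) :
    |smoothMinMax β δ x - ⨅ i, ⨆ j, x i j|
      ≤ max (log (Fintype.card ι) / (β * δ)) (log (Fintype.card κ) / β) := by
  have hβδ : 0 < β * δ := mul_pos hβ hδ
  obtain ⟨i₀, hi₀⟩ := Finite.exists_min fun i => ⨆ j, x i j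
  have hZ : ⨅ i, ⨆ j, x i j = ⨆ j, x i₀ j :=
    le_antisymm (ciInf_le (Set.finite_range _).bddBelow i₀) (le_ciInf hi₀)
  rw [hZ]
  set Z := ⨆ j, x i₀ j
  have hupper : logSumExp (fun j => β * x i₀ j) ≤ log (Fintype.card κ) + β * Z :=
    logSumExp_le fun j => mul_le_mul_of_nonneg_left
      (le_ciSup (Set.finite_range fun j => x i₀ j).bddAbove j) hβ.le
  have hlower : ∀ i, β * Z ≤ logSumExp fun j => β * x i j := fun i => by
    obtain ⟨j₀, hj₀⟩ := Finite.exists_max (x i)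
    have h1 : Z ≤ x i j₀ := (hi₀ i).trans (ciSup_le hj₀)
    exact (mul_le_mul_of_nonneg_left h1 hβ.le).trans (le_logSumExp (fun j => β * x i j) j₀)
  have h1 := le_logSumExp (fun i => -δ * logSumExp fun j => β * x i j) i₀
  have h2 : logSumExp (fun i => -δ * logSumExp fun j => β * x i j)
      ≤ log (Fintype.card ι) + -δ * (β * Z) :=
    logSumExp_le fun i => mul_le_mul_of_nonpos_left (hlower i) (by linarith)
  rw [smoothMinMax]
  set L := logSumExp fun i => -δ * logSumExp fun j => β * x i j
  have e : -(β * δ)⁻¹ * L - Z = -(L + β * δ * Z) / (β * δ) := by field_simp; ring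
  rw [e, abs_le]
  constructor
  · refine (neg_le_neg (le_max_left _ _)).trans ?_
    rw [← neg_div]
    gcongr
    linarith
  · refine le_trans ?_ (le_max_right _ _)
    rw [div_le_div_iff₀ hβδ hβ]
    have h3 : -δ * (log (Fintype.card κ) + β * Z) ≤ L :=
      (mul_le_mul_of_nonpos_left hupper (by linarith)).trans h1
    nlinarith

/-- The average of the diagonal entries of a second-moment tensor. -/
noncomputable def diagAvg {ι κ : Type*} [Fintype ι] [Fintype κ] (d : ι → κ → ι → κ → ℝ) : ℝ :=
  softAvg 0 fun i => softAvg 0 fun j => d i j i j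

/-- The average of the within-row entries of a second-moment tensor. -/
noncomputable def rowAvg {ι κ : Type*} [Fintype ι] [Fintype κ] (d : ι → κ → ι → κ → ℝ) : ℝ :=
  softAvg 0 fun i => softAvg 0 fun j => softAvg 0 fun l => d i j i l

/-- The average of all entries of a second-moment tensor. -/
noncomputable def fullAvg {ι κ : Type*} [Fintype ι] [Fintype κ] (d : ι → κ → ι → κ → ℝ) : ℝ :=
  softAvg 0 fun i => softAvg 0 fun j => softAvg 0 fun k => softAvg 0 fun l => d i j k l

/-- The second-order coefficient at the origin of a smooth function of `smoothMinMax`, as a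
linear function of the second-moment tensor `d`; here `p` and `q` stand for the first and second
derivatives of the outer function. -/
noncomputable def secondOrder {ι κ : Type*} [Fintype ι] [Fintype κ] (β δ p q : ℝ)
    (d : ι → κ → ι → κ → ℝ) : ℝ :=
  p * β * diagAvg d - p * (β * (1 + δ)) * rowAvg d + (q + p * (β * δ)) * fullAvg d

lemma boundedJet_smoothMinMax [Nonempty ι] [Nonempty κ]
    {β δ K : ℝ} (hβ : 0 < β) (hδ : 0 < δ) {x : ι → κ → ℝ}
    (hx : ∀ i j, |x i j| ≤ K) :
    ∃ f₁ f₂ : ℝ → ℝ, BoundedJet (fun t => smoothMinMax β δ fun i j => t * x i j) f₁ f₂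
        K (2 * (β * (1 + δ)) * K ^ 2) (6 * (β * (1 + δ)) ^ 2 * K ^ 3) ∧
      f₁ 0 = (softAvg 0 fun i => softAvg 0 fun j => x i j) ∧
      f₂ 0 = β * diagAvg (fun i j k l => x i j * x k l)
        - β * (1 + δ) * rowAvg (fun i j k l => x i j * x k l)
        + β * δ * fullAvg (fun i j k l => x i j * x k l) := by
  have hlin : ∀ i j, BoundedJet (fun t => β * (t * x i j)) (fun _ => β * x i j) (fun _ => 0)
      (β * K) 0 0 := fun i j =>
    ⟨fun t => by simpa using ((hasDerivAt_id t).mul_const (x i j)).const_mul β,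
      fun t => hasDerivAt_const _ _, fun t => ⟨0, hasDerivAt_const _ _, by simp⟩,
      fun t => by rw [abs_mul, abs_of_pos hβ]; gcongr; exact hx i j, fun t => by simp⟩
  have hrow := fun i => (BoundedJet.logSumExp_comp (hlin i)).const_mul (-δ)
  have htot := (BoundedJet.logSumExp_comp hrow).const_mul (-(β * δ)⁻¹)
  have hβδ : (0 : ℝ) < (β * δ)⁻¹ := by positivity
  rw [abs_neg, abs_neg, abs_of_pos hδ, abs_of_pos hβδ] at htot
  have ha₁ : (β * δ)⁻¹ * (δ * (β * K)) = K := by field_simp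
  have ha₂ : (β * δ)⁻¹ * (δ * (0 + 2 * (β * K) ^ 2) + 2 * (δ * (β * K)) ^ 2)
      = 2 * (β * (1 + δ)) * K ^ 2 := by field_simp; ring
  have ha₃ : (β * δ)⁻¹ * (δ * (0 + 6 * (β * K * 0) + 6 * (β * K) ^ 3)
        + 6 * (δ * (β * K) * (δ * (0 + 2 * (β * K) ^ 2))) + 6 * (δ * (β * K)) ^ 3)
      = 6 * (β * (1 + δ)) ^ 2 * K ^ 3 := by field_simp; ring
  rw [ha₁, ha₂, ha₃] at htot
  refine ⟨_, _, htot, ?_, ?_⟩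
  · simp only [zero_mul, mul_zero, softAvg_const_left, softAvg_mul_left]
    field_simp
  · have hzero : softAvg (0 : κ → ℝ) (fun _ => (0 : ℝ)) = 0 := by simp [softAvg]
    have hsq : ∀ i, softAvg 0 (fun j => β * x i j * (β * x i j))
        = β ^ 2 * softAvg 0 (fun j => x i j * x i j) := fun i => by
      rw [← softAvg_mul_left]
      congr 1 with j
      ring
    have hrow₂ : (fun i => 0 + β ^ 2 * softAvg 0 (fun j => x i j * x i j)
        - β * softAvg 0 (x i) * (β * softAvg 0 (x i)))
        = fun i => β ^ 2 * softAvg 0 (fun j => x i j * x i j)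
          - β ^ 2 * (softAvg 0 (x i) * softAvg 0 (x i)) := by
      funext i; ring
    have hrow₁ : (fun i => -δ * (β * softAvg 0 (x i)) * (-δ * (β * softAvg 0 (x i))))
        = fun i => β ^ 2 * δ ^ 2 * (softAvg 0 (x i) * softAvg 0 (x i)) := by
      funext i; ring
    simp only [zero_mul, mul_zero, softAvg_const_left, softAvg_mul_left, softAvg_mul_right,
      diagAvg, rowAvg, fullAvg, hzero, hsq]
    rw [hrow₁, hrow₂, softAvg_sub]
    simp only [softAvg_mul_left]
    field_simp
    ring

end SmoothMinMax

lemma integrable_of_integrable_abs_pow_three {Ω : Type*} [MeasurableSpace Ω] {P : Measure Ω}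
    [IsFiniteMeasure P] {f : Ω → ℝ} (hf : Measurable f)
    (hf₃ : Integrable (fun ω => |f ω| ^ 3) P) : Integrable f P := by
  refine ((integrable_const (1 : ℝ)).add hf₃).mono' hf.aestronglyMeasurable
    (Filter.Eventually.of_forall fun ω => ?_)
  simp only [Pi.add_apply, Real.norm_eq_abs]
  have := abs_nonneg (f ω)
  nlinarith [sq_nonneg (|f ω| - 1), mul_nonneg this (sq_nonneg (|f ω| - 1))]

lemma integrable_mul_of_integrable_abs_pow_three {Ω : Type*} [MeasurableSpace Ω]
    {P : Measure Ω} [IsFiniteMeasure P] {f g : Ω → ℝ} (hf : Measurable f) (hg : Measurable g)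
    (hf₃ : Integrable (fun ω => |f ω| ^ 3) P) (hg₃ : Integrable (fun ω => |g ω| ^ 3) P) :
    Integrable (fun ω => f ω * g ω) P := by
  refine (((integrable_const (1 : ℝ)).add hf₃).add hg₃).mono'
    (hf.mul hg).aestronglyMeasurable (Filter.Eventually.of_forall fun ω => ?_)
  simp only [Pi.add_apply, Real.norm_eq_abs, abs_mul]
  have h1 := abs_nonneg (f ω)
  have h2 := abs_nonneg (g ω)
  have h3 : ∀ a : ℝ, 0 ≤ a → a ^ 2 ≤ 1 + a ^ 3 := fun a ha => by
    nlinarith [mul_nonneg ha (sq_nonneg (a - 1)), sq_nonneg (a - 1)]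
  nlinarith [h3 _ h1, h3 _ h2, sq_nonneg (|f ω| - |g ω|), pow_nonneg h1 3, pow_nonneg h2 3]

section Comparison

variable {ι κ : Type*} [Fintype ι] [Fintype κ]

lemma secondOrder_sub (β δ p q : ℝ) (d e : ι → κ → ι → κ → ℝ) :
    secondOrder β δ p q (fun i j k l => d i j k l - e i j k l)
      = secondOrder β δ p q d - secondOrder β δ p q e := by
  simp only [secondOrder, diagAvg, rowAvg, fullAvg, softAvg_sub]
  ring

lemma abs_secondOrder_le [Nonempty ι] [Nonempty κ] {β δ : ℝ} (hβ : 0 < β) (hδ : 0 < δ)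
    (p q : ℝ) {d : ι → κ → ι → κ → ℝ} {c : ℝ} (h : ∀ i j k l, |d i j k l| ≤ c) :
    |secondOrder β δ p q d| ≤ (|q| + 2 * (β * (1 + δ)) * |p|) * c := by
  have h1 : |diagAvg d| ≤ c := abs_softAvg_le _ fun i => abs_softAvg_le _ fun j => h i j i j
  have h2 : |rowAvg d| ≤ c := abs_softAvg_le _ fun i => abs_softAvg_le _ fun j =>
    abs_softAvg_le _ fun l => h i j i l
  have h3 : |fullAvg d| ≤ c := abs_softAvg_le _ fun i => abs_softAvg_le _ fun j =>
    abs_softAvg_le _ fun k => abs_softAvg_le _ fun l => h i j k l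
  calc |secondOrder β δ p q d|
      ≤ |p * β * diagAvg d| + |p * (β * (1 + δ)) * rowAvg d|
        + |(q + p * (β * δ)) * fullAvg d| :=
        (abs_add_le _ _).trans (add_le_add_left (abs_sub _ _) _)
    _ ≤ |p| * β * c + |p| * (β * (1 + δ)) * c + (|q| + |p| * (β * δ)) * c := by
        have h4 : |q + p * (β * δ)| ≤ |q| + |p| * (β * δ) := by
          refine (abs_add_le _ _).trans_eq ?_
          rw [abs_mul p, abs_of_pos (mul_pos hβ hδ)]
        simp only [abs_mul, abs_of_pos hβ, abs_of_pos (show 0 < 1 + δ by linarith)]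
        gcongr
    _ = _ := by ring

lemma integrable_secondOrder {Ω : Type*} [MeasurableSpace Ω] {P : Measure Ω} (β δ p q : ℝ)
    {d : Ω → ι → κ → ι → κ → ℝ} (h : ∀ i j k l, Integrable (fun ω => d ω i j k l) P) :
    Integrable (fun ω => secondOrder β δ p q (d ω)) P := by
  refine ((Integrable.const_mul ?_ _).sub (Integrable.const_mul ?_ _)).add
    (Integrable.const_mul ?_ _)
  · exact integrable_softAvg _ fun i => integrable_softAvg _ fun j => h i j i j
  · exact integrable_softAvg _ fun i => integrable_softAvg _ fun j =>
      integrable_softAvg _ fun l => h i j i l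
  · exact integrable_softAvg _ fun i => integrable_softAvg _ fun j =>
      integrable_softAvg _ fun k => integrable_softAvg _ fun l => h i j k l

lemma integral_secondOrder {Ω : Type*} [MeasurableSpace Ω] {P : Measure Ω} (β δ p q : ℝ)
    {d : Ω → ι → κ → ι → κ → ℝ} (h : ∀ i j k l, Integrable (fun ω => d ω i j k l) P) :
    ∫ ω, secondOrder β δ p q (d ω) ∂P
      = secondOrder β δ p q (fun i j k l => ∫ ω, d ω i j k l ∂P) := by
  have i1 : ∀ i, Integrable (fun ω => softAvg 0 fun j => d ω i j i j) P := fun i =>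
    integrable_softAvg _ fun j => h i j i j
  have i2 : ∀ i j, Integrable (fun ω => softAvg 0 fun l => d ω i j i l) P := fun i j =>
    integrable_softAvg _ fun l => h i j i l
  have i2' : ∀ i, Integrable (fun ω => softAvg 0 fun j => softAvg 0 fun l => d ω i j i l) P :=
    fun i => integrable_softAvg _ (i2 i)
  have i3 : ∀ i j k, Integrable (fun ω => softAvg 0 fun l => d ω i j k l) P := fun i j k =>
    integrable_softAvg _ fun l => h i j k l
  have i3' : ∀ i j, Integrable (fun ω => softAvg 0 fun k => softAvg 0 fun l => d ω i j k l) P :=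
    fun i j => integrable_softAvg _ (i3 i j)
  have i3'' : ∀ i, Integrable (fun ω => softAvg 0 fun j => softAvg 0 fun k => softAvg 0 fun l =>
      d ω i j k l) P := fun i => integrable_softAvg _ (i3' i)
  have e1 : ∫ ω, diagAvg (d ω) ∂P = diagAvg fun i j k l => ∫ ω, d ω i j k l ∂P := by
    simp only [diagAvg]
    rw [integral_softAvg _ i1]
    congr 1 with i
    exact integral_softAvg _ fun j => h i j i j
  have e2 : ∫ ω, rowAvg (d ω) ∂P = rowAvg fun i j k l => ∫ ω, d ω i j k l ∂P := by
    simp only [rowAvg]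
    rw [integral_softAvg _ i2']
    congr 1 with i
    rw [integral_softAvg _ (i2 i)]
    congr 1 with j
    exact integral_softAvg _ fun l => h i j i l
  have e3 : ∫ ω, fullAvg (d ω) ∂P = fullAvg fun i j k l => ∫ ω, d ω i j k l ∂P := by
    simp only [fullAvg]
    rw [integral_softAvg _ i3'']
    congr 1 with i
    rw [integral_softAvg _ (i3' i)]
    congr 1 with j
    rw [integral_softAvg _ (i3 i j)]
    congr 1 with k
    exact integral_softAvg _ fun l => h i j k l
  have j1 : Integrable (fun ω => diagAvg (d ω)) P := integrable_softAvg _ i1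
  have j2 : Integrable (fun ω => rowAvg (d ω)) P := integrable_softAvg _ i2'
  have j3 : Integrable (fun ω => fullAvg (d ω)) P := integrable_softAvg _ i3''
  simp only [secondOrder]
  refine (integral_add ((j1.const_mul _).sub (j2.const_mul _)) (j3.const_mul _)).trans ?_
  rw [integral_const_mul, e3]
  congr 1
  refine (integral_sub (j1.const_mul _) (j2.const_mul _)).trans ?_
  rw [integral_const_mul, integral_const_mul, e1, e2]

/-- Second-order Taylor estimate for a rescaled smooth function of `smoothMinMax`. -/
lemma abs_taylor_smoothMinMax_le [Nonempty ι] [Nonempty κ]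
    {β δ τ K C : ℝ} (hβ : 0 < β) (hδ : 0 < δ) (hτ : 0 < τ)
    (hβτ : τ⁻¹ ≤ β * (1 + δ)) {g g₁ g₂ : ℝ → ℝ} (hg : BoundedJet g g₁ g₂ C C C)
    {x : ι → κ → ℝ} (hx : ∀ i j, |x i j| ≤ K) {a : ℝ}
    (ha : a = τ⁻¹ * smoothMinMax β δ (0 : ι → κ → ℝ)) :
    |g (τ⁻¹ * smoothMinMax β δ x)
        - (g a + g₁ a * τ⁻¹ * (softAvg 0 fun i => softAvg 0 fun j => x i j)
          + secondOrder β δ (g₁ a * τ⁻¹) (g₂ a * τ⁻¹ ^ 2) (fun i j k l => x i j * x k l) / 2)|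
      ≤ 13 * C * τ⁻¹ * (β * (1 + δ)) ^ 2 * K ^ 3 := by
  obtain ⟨f₁, f₂, hf, hf₁, hf₂⟩ := boundedJet_smoothMinMax hβ hδ hx
  have hτ' : 0 < τ⁻¹ := inv_pos.2 hτ
  have hK : 0 ≤ K := (abs_nonneg _).trans (hx (Classical.arbitrary ι) (Classical.arbitrary κ))
  have hC : 0 ≤ C := (abs_nonneg _).trans (hg.first_le 0)
  have h := (hg.comp (hf.const_mul τ⁻¹)).abs_taylor_le
  have hzero : (fun (i : ι) (j : κ) => 0 * x i j) = 0 := by ext; simp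
  have hone : (fun (i : ι) (j : κ) => 1 * x i j) = x := by ext; simp
  simp only [hzero, hone, hf₁, hf₂, ← ha, abs_of_pos hτ'] at h
  have hfull : fullAvg (fun i j k l => x i j * x k l)
      = (softAvg 0 fun i => softAvg 0 fun j => x i j) ^ 2 := by
    simp only [fullAvg, softAvg_mul_left, softAvg_mul_right]
    ring
  refine le_trans (le_of_eq ?_) (h.trans ?_)
  · congr 1
    rw [secondOrder, hfull]
    ring
  · set b := β * (1 + δ)
    have hb : 0 < b := by positivity
    have e : C * (τ⁻¹ * K) ^ 3 + 3 * (C * (τ⁻¹ * K) * (τ⁻¹ * (2 * b * K ^ 2)))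
        + C * (τ⁻¹ * (6 * b ^ 2 * K ^ 3))
        = C * τ⁻¹ * K ^ 3 * (τ⁻¹ ^ 2 + 6 * b * τ⁻¹ + 6 * b ^ 2) := by ring
    rw [e, show 13 * C * τ⁻¹ * b ^ 2 * K ^ 3 = C * τ⁻¹ * K ^ 3 * (13 * b ^ 2) by ring]
    refine mul_le_mul_of_nonneg_left ?_ (by positivity)
    nlinarith

lemma measurable_smoothMinMax {Ω : Type*} [MeasurableSpace Ω] (β δ : ℝ)
    {X : Ω → ι → κ → ℝ} (hX : ∀ i j, Measurable fun ω => X ω i j) :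
    Measurable fun ω => smoothMinMax β δ (X ω) := by
  unfold smoothMinMax logSumExp
  fun_prop

lemma abs_pow_three_le_iSup (x : ι → κ → ℝ) (i : ι) (j : κ) :
    |x i j| ^ 3 ≤ ⨆ i, ⨆ j, |x i j| ^ 3 :=
  (le_ciSup (f := fun j => |x i j| ^ 3) (Set.finite_range _).bddAbove j).trans
    (le_ciSup (f := fun i => ⨆ j, |x i j| ^ 3) (Set.finite_range _).bddAbove i)

lemma exists_abs_le_and_pow_three_le_iSup [Nonempty ι] [Nonempty κ] (x : ι → κ → ℝ) :
    ∃ K, (∀ i j, |x i j| ≤ K) ∧ K ^ 3 ≤ ⨆ i, ⨆ j, |x i j| ^ 3 := by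
  obtain ⟨⟨i₀, j₀⟩, h⟩ := Finite.exists_max fun p : ι × κ => |x p.1 p.2|
  exact ⟨|x i₀ j₀|, fun i j => h (i, j), abs_pow_three_le_iSup x i₀ j₀⟩

lemma integrable_iSup_abs_pow_three [Nonempty ι] [Nonempty κ]
    {Ω : Type*} [MeasurableSpace Ω] {P : Measure Ω}
    {X : Ω → ι → κ → ℝ} (hX : ∀ i j, Measurable fun ω => X ω i j)
    (hX₃ : ∀ i j, Integrable (fun ω => |X ω i j| ^ 3) P) :
    Integrable (fun ω => ⨆ i, ⨆ j, |X ω i j| ^ 3) P := by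
  refine (integrable_finsetSum Finset.univ fun i _ =>
    integrable_finsetSum Finset.univ fun j _ => hX₃ i j).mono' ?_
    (Filter.Eventually.of_forall fun ω => ?_)
  · exact (Measurable.iSup fun i => Measurable.iSup fun j =>
      ((hX i j).abs.pow_const 3)).aestronglyMeasurable
  · rw [Real.norm_eq_abs, abs_of_nonneg
      (Real.iSup_nonneg fun i => Real.iSup_nonneg fun j => by positivity)]
    refine ciSup_le fun i => ciSup_le fun j => ?_
    refine (Finset.single_le_sum (f := fun j => |X ω i j| ^ 3) (fun j _ => by positivity)
      (Finset.mem_univ j)).trans ?_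
    exact Finset.single_le_sum (f := fun i => ∑ j, |X ω i j| ^ 3)
      (fun i _ => Finset.sum_nonneg fun j _ => by positivity) (Finset.mem_univ i)

lemma integrable_comp_smoothMinMax {Ω : Type*} [MeasurableSpace Ω] {P : Measure Ω}
    [IsFiniteMeasure P] (β δ τ : ℝ) {g : ℝ → ℝ} (hg : Continuous g)
    (hg₀ : ∀ x, 0 ≤ g x) (hg₁ : ∀ x, g x ≤ 1)
    {X : Ω → ι → κ → ℝ} (hX : ∀ i j, Measurable fun ω => X ω i j) :
    Integrable (fun ω => g (τ⁻¹ * smoothMinMax β δ (X ω))) P :=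
  (integrable_const (1 : ℝ)).mono'
    (hg.measurable.comp ((measurable_smoothMinMax β δ hX).const_mul τ⁻¹)).aestronglyMeasurable
    (Filter.Eventually.of_forall fun ω => by
      simpa only [Real.norm_eq_abs, abs_of_nonneg (hg₀ _)] using hg₁ _)

lemma abs_integral_comp_smoothMinMax_sub_le [Nonempty ι] [Nonempty κ]
    {Ω : Type*} [MeasurableSpace Ω] {P : Measure Ω}
    [IsProbabilityMeasure P] {β δ τ C : ℝ} (hβ : 0 < β) (hδ : 0 < δ) (hτ : 0 < τ)
    (hβτ : τ⁻¹ ≤ β * (1 + δ)) {g g₁ g₂ : ℝ → ℝ} (hg : BoundedJet g g₁ g₂ C C C)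
    (hg₀ : ∀ x, 0 ≤ g x) (hg₁ : ∀ x, g x ≤ 1)
    {X : Ω → ι → κ → ℝ} (hX : ∀ i j, Measurable fun ω => X ω i j)
    (hX₁ : ∀ i j, ∫ ω, X ω i j ∂P = 0)
    (hX₃ : ∀ i j, Integrable (fun ω => |X ω i j| ^ 3) P) {a : ℝ}
    (ha : a = τ⁻¹ * smoothMinMax β δ (0 : ι → κ → ℝ)) :
    |∫ ω, g (τ⁻¹ * smoothMinMax β δ (X ω)) ∂P
        - (g a + secondOrder β δ (g₁ a * τ⁻¹) (g₂ a * τ⁻¹ ^ 2)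
          (fun i j k l => ∫ ω, X ω i j * X ω k l ∂P) / 2)|
      ≤ 13 * C * τ⁻¹ * (β * (1 + δ)) ^ 2 * ∫ ω, ⨆ i, ⨆ j, |X ω i j| ^ 3 ∂P := by
  have hC : 0 ≤ C := (abs_nonneg _).trans (hg.first_le 0)
  have hX_int := fun i j => integrable_of_integrable_abs_pow_three (hX i j) (hX₃ i j)
  have hXX_int := fun i j k l =>
    integrable_mul_of_integrable_abs_pow_three (hX i j) (hX k l) (hX₃ i j) (hX₃ k l)
  have hrow := fun i => integrable_softAvg (0 : κ → ℝ) (hX_int i)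
  have hmean : ∫ ω, (softAvg (0 : ι → ℝ) fun i => softAvg (0 : κ → ℝ) fun j => X ω i j) ∂P = 0 := by
    rw [integral_softAvg _ hrow]
    simp only [fun i => integral_softAvg (0 : κ → ℝ) (hX_int i), hX₁]
    simp [softAvg]
  have i1 := (integrable_softAvg (0 : ι → ℝ) hrow).const_mul (g₁ a * τ⁻¹)
  have i2 := (integrable_secondOrder β δ (g₁ a * τ⁻¹) (g₂ a * τ⁻¹ ^ 2) hXX_int).div_const 2
  have i0 := integrable_comp_smoothMinMax (P := P) β δ τ hg.continuous hg₀ hg₁ hX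
  have i3 := ((integrable_const (μ := P) (g a)).add i1).add i2
  have key : ∫ ω, g (τ⁻¹ * smoothMinMax β δ (X ω)) ∂P
        - (g a + secondOrder β δ (g₁ a * τ⁻¹) (g₂ a * τ⁻¹ ^ 2)
          (fun i j k l => ∫ ω, X ω i j * X ω k l ∂P) / 2)
      = ∫ ω, (g (τ⁻¹ * smoothMinMax β δ (X ω))
        - (g a + g₁ a * τ⁻¹ * (softAvg 0 fun i => softAvg 0 fun j => X ω i j)
          + secondOrder β δ (g₁ a * τ⁻¹) (g₂ a * τ⁻¹ ^ 2)
            (fun i j k l => X ω i j * X ω k l) / 2)) ∂P := by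
    refine Eq.trans ?_ (integral_sub i0 i3).symm
    congr 1
    refine Eq.trans ?_ (integral_add ((integrable_const (g a)).add i1) i2).symm
    rw [integral_div, integral_secondOrder _ _ _ _ hXX_int]
    congr 1
    refine Eq.trans ?_ (integral_add (integrable_const (g a)) i1).symm
    rw [integral_const_mul, hmean]
    simp
  rw [key, ← Real.norm_eq_abs, ← integral_const_mul]
  refine norm_integral_le_of_norm_le ((integrable_iSup_abs_pow_three hX hX₃).const_mul _)
    (Filter.Eventually.of_forall fun ω => ?_)
  obtain ⟨K, hK, hK₃⟩ := exists_abs_le_and_pow_three_le_iSup (X ω)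
  exact (abs_taylor_smoothMinMax_le hβ hδ hτ hβτ hg hK ha).trans
    (mul_le_mul_of_nonneg_left hK₃ (by have := inv_pos.2 hτ; positivity))

lemma integral_comp_smoothMinMax_le [Nonempty ι] [Nonempty κ]
    {Ω : Type*} [MeasurableSpace Ω] {P : Measure Ω}
    [IsProbabilityMeasure P] {β δ τ C : ℝ} (hβ : 0 < β) (hδ : 0 < δ) (hτ : 0 < τ)
    (hβτ : τ⁻¹ ≤ β * (1 + δ)) {g g₁ g₂ : ℝ → ℝ} (hg : BoundedJet g g₁ g₂ C C C)
    (hg₀ : ∀ x, 0 ≤ g x) (hg₁ : ∀ x, g x ≤ 1)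
    {X X' : Ω → ι → κ → ℝ} (hX : ∀ i j, Measurable fun ω => X ω i j)
    (hX' : ∀ i j, Measurable fun ω => X' ω i j)
    (hX₁ : ∀ i j, ∫ ω, X ω i j ∂P = 0) (hX'₁ : ∀ i j, ∫ ω, X' ω i j ∂P = 0)
    (hX₃ : ∀ i j, Integrable (fun ω => |X ω i j| ^ 3) P)
    (hX'₃ : ∀ i j, Integrable (fun ω => |X' ω i j| ^ 3) P) :
    ∫ ω, g (τ⁻¹ * smoothMinMax β δ (X ω)) ∂P
      ≤ ∫ ω, g (τ⁻¹ * smoothMinMax β δ (X' ω)) ∂P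
        + 13 * C * β * (1 + δ) * τ⁻¹ *
          ((⨆ i₁, ⨆ j₁, ⨆ i₂, ⨆ j₂, |∫ ω, (X ω i₁ j₁ * X ω i₂ j₂ - X' ω i₁ j₁ * X' ω i₂ j₂) ∂P|)
            + β * (1 + δ) * ((∫ ω, ⨆ i, ⨆ j, |X ω i j| ^ 3 ∂P)
              + ∫ ω, ⨆ i, ⨆ j, |X' ω i j| ^ 3 ∂P)) := by
  have hC : 0 ≤ C := (abs_nonneg _).trans (hg.first_le 0)
  have hτ' : 0 < τ⁻¹ := inv_pos.2 hτ
  set a := τ⁻¹ * smoothMinMax β δ (0 : ι → κ → ℝ) with ha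
  have h1 := abs_le.1 (abs_integral_comp_smoothMinMax_sub_le hβ hδ hτ hβτ hg hg₀ hg₁ hX hX₁ hX₃
    ha)
  have h2 := abs_le.1
    (abs_integral_comp_smoothMinMax_sub_le hβ hδ hτ hβτ hg hg₀ hg₁ hX' hX'₁ hX'₃ ha)
  set B₃ := ⨆ i₁, ⨆ j₁, ⨆ i₂, ⨆ j₂, |∫ ω, (X ω i₁ j₁ * X ω i₂ j₂ - X' ω i₁ j₁ * X' ω i₂ j₂) ∂P|
    with hB₃
  have hB₃_le : ∀ i j k l, |∫ ω, X ω i j * X ω k l ∂P - ∫ ω, X' ω i j * X' ω k l ∂P| ≤ B₃ :=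
    fun i j k l => by
      rw [← integral_sub (integrable_mul_of_integrable_abs_pow_three (hX i j) (hX k l) (hX₃ i j)
        (hX₃ k l)) (integrable_mul_of_integrable_abs_pow_three (hX' i j) (hX' k l) (hX'₃ i j)
        (hX'₃ k l))]
      exact le_ciSup_of_le (Set.finite_range _).bddAbove i <|
        le_ciSup_of_le (Set.finite_range _).bddAbove j <|
        le_ciSup_of_le (Set.finite_range _).bddAbove k <|
        le_ciSup_of_le (Set.finite_range _).bddAbove l le_rfl
  have hB₃_nonneg : 0 ≤ B₃ := (abs_nonneg _).trans (hB₃_le (Classical.arbitrary ι)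
    (Classical.arbitrary κ) (Classical.arbitrary ι) (Classical.arbitrary κ))
  have h3 := (le_abs_self _).trans
    (abs_secondOrder_le hβ hδ (g₁ a * τ⁻¹) (g₂ a * τ⁻¹ ^ 2) hB₃_le)
  rw [secondOrder_sub] at h3
  have h4 : |g₂ a * τ⁻¹ ^ 2| + 2 * (β * (1 + δ)) * |g₁ a * τ⁻¹| ≤ 3 * C * τ⁻¹ * (β * (1 + δ)) := by
    rw [abs_mul, abs_mul, abs_of_pos hτ', abs_of_pos (pow_pos hτ' 2)]
    have h5 := hg.first_le a
    have h6 := hg.second_le a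
    calc |g₂ a| * τ⁻¹ ^ 2 + 2 * (β * (1 + δ)) * (|g₁ a| * τ⁻¹)
        ≤ C * (τ⁻¹ * (β * (1 + δ))) + 2 * (β * (1 + δ)) * (C * τ⁻¹) := by
          rw [pow_two]; gcongr
      _ = _ := by ring
  have h5 := h3.trans (mul_le_mul_of_nonneg_right h4 hB₃_nonneg)
  have h6 : 0 ≤ C * τ⁻¹ * (β * (1 + δ)) * B₃ := by positivity
  linarith [h1.2, h2.1]

end Comparison

theorem stmt_2 :
    ∃ C : ℝ, 0 < C ∧
      ∀ (n m : ℕ), 1 ≤ n → 1 ≤ m →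
      ∀ (Ω : Type) [MeasurableSpace Ω] (P : Measure Ω), IsProbabilityMeasure P →
      ∀ (X X' : Ω → Fin n → Fin m → ℝ), Measurable X → Measurable X' →
      (∀ i j, ∫ ω, X ω i j ∂P = 0) → (∀ i j, ∫ ω, X' ω i j ∂P = 0) →
      (∀ i j, Integrable (fun ω => |X ω i j| ^ 3) P) →
      (∀ i j, Integrable (fun ω => |X' ω i j| ^ 3) P) →
      ∀ (β δ τ : ℝ), 0 < β → 0 < δ → 1 / (β * (1 + δ)) < τ →
      ∀ A : Set ℝ, MeasurableSet A →
        P {ω | (⨅ i, ⨆ j, X ω i j) ∈ A}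
          ≤ P {ω | (⨅ i, ⨆ j, X' ω i j) ∈
                Metric.cthickening
                  (2 * max (Real.log n / (β * δ)) (Real.log m / β) + 3 * τ) A}
            + ENNReal.ofReal
              ((Real.sqrt (Real.exp (-(β ^ 2 * (1 + δ) ^ 2 * τ ^ 2 - 1)) *
                    (1 + (β ^ 2 * (1 + δ) ^ 2 * τ ^ 2 - 1)))
                + C * β * (1 + δ) * τ⁻¹ *
                  ((∫ ω, ⨆ i₁, ⨆ j₁, ⨆ i₂, ⨆ j₂,
                      |X ω i₁ j₁ * X ω i₂ j₂ - ∫ ω', X ω' i₁ j₁ * X ω' i₂ j₂ ∂P| ∂P)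
                    + (∫ ω, ⨆ i₁, ⨆ j₁, ⨆ i₂, ⨆ j₂,
                        |X' ω i₁ j₁ * X' ω i₂ j₂ - ∫ ω', X' ω' i₁ j₁ * X' ω' i₂ j₂ ∂P| ∂P)
                    + (⨆ i₁, ⨆ j₁, ⨆ i₂, ⨆ j₂,
                        |∫ ω, (X ω i₁ j₁ * X ω i₂ j₂ - X' ω i₁ j₁ * X' ω i₂ j₂) ∂P|)
                    + β * (1 + δ) *
                        ((∫ ω, ⨆ i, ⨆ j, |X ω i j| ^ 3 ∂P)
                          + ∫ ω, ⨆ i, ⨆ j, |X' ω i j| ^ 3 ∂P))) /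
                (1 - Real.sqrt (Real.exp (-(β ^ 2 * (1 + δ) ^ 2 * τ ^ 2 - 1)) *
                    (1 + (β ^ 2 * (1 + δ) ^ 2 * τ ^ 2 - 1))))) := by
  obtain ⟨C, hC, hsmooth⟩ := exists_smooth_indicator
  refine ⟨13 * C, by positivity, ?_⟩
  intro n m hn hm Ω _ P _ X X' hX hX' hX₁ hX'₁ hX₃ hX'₃ β δ τ hβ hδ hβτ A _
  have : Nonempty (Fin n) := ⟨⟨0, hn⟩⟩
  have : Nonempty (Fin m) := ⟨⟨0, hm⟩⟩
  have hb : 0 < β * (1 + δ) := by positivity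
  have hτ : 0 < τ := lt_trans (by positivity) hβτ
  have hbτ : 1 < β * (1 + δ) * τ := by rwa [div_lt_iff₀ hb, mul_comm] at hβτ
  have hτ_inv : τ⁻¹ ≤ β * (1 + δ) := by
    rw [inv_le_iff_one_le_mul₀ hτ]
    exact hbτ.le
  set r := max (Real.log n / (β * δ)) (Real.log m / β) with hr
  have hr₀ : 0 ≤ r := (div_nonneg (Real.log_natCast_nonneg n) (by positivity)).trans
    (le_max_left _ _)
  have happrox : ∀ x : Fin n → Fin m → ℝ, |smoothMinMax β δ x - ⨅ i, ⨆ j, x i j| ≤ r :=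
    fun x => by simpa only [Fintype.card_fin] using abs_smoothMinMax_sub_le hβ hδ x
  obtain ⟨g, g₁, g₂, hg, hg_nonneg, hg_le, hg_one, hg_zero⟩ :=
    hsmooth ((fun y => τ * y) ⁻¹' Metric.cthickening (r + τ) A)
      (Metric.isClosed_cthickening.preimage (continuous_const_mul τ)).measurableSet
  have hscale : ∀ y t, |τ⁻¹ * y - t| ≤ 1 → dist (τ * t) y ≤ τ := fun y t h => by
    have e : τ * t - y = -(τ * (τ⁻¹ * y - t)) := by field_simp; ring
    rw [Real.dist_eq, e, abs_neg, abs_mul, abs_of_pos hτ]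
    exact mul_le_of_le_one_right hτ.le h
  have hone : ∀ x : Fin n → Fin m → ℝ, (⨅ i, ⨆ j, x i j) ∈ A →
      g (τ⁻¹ * smoothMinMax β δ x) = 1 := fun x hx => hg_one _ fun t ht =>
    Metric.mem_cthickening_of_dist_le _ _ _ _ hx <| by
      have h1 := dist_triangle (τ * t) (smoothMinMax β δ x) (⨅ i, ⨆ j, x i j)
      have h2 := hscale _ t ht
      have h3 := happrox x
      rw [← Real.dist_eq] at h3
      linarith
  have hzero : ∀ x : Fin n → Fin m → ℝ, (⨅ i, ⨆ j, x i j) ∉ Metric.cthickening (2 * r + 3 * τ) A →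
      g (τ⁻¹ * smoothMinMax β δ x) = 0 := fun x hx => hg_zero _ fun t ht hmem => hx <| by
    have h1 : (⨅ i, ⨆ j, x i j) ∈ Metric.cthickening (r + τ) (Metric.cthickening (r + τ) A) := by
      refine Metric.mem_cthickening_of_dist_le _ _ _ _ hmem ?_
      have h1 := dist_triangle (τ * t) (smoothMinMax β δ x) (⨅ i, ⨆ j, x i j)
      have h2 := hscale _ t ht
      have h3 := happrox x
      rw [← Real.dist_eq] at h3
      rw [dist_comm]
      linarith
    have h2 := Metric.cthickening_cthickening_subset (by positivity) (by positivity) A h1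
    exact Metric.cthickening_mono (by linarith) A h2
  have hX_meas : ∀ i j, Measurable fun ω => X ω i j := fun i j => by fun_prop
  have hX'_meas : ∀ i j, Measurable fun ω => X' ω i j := fun i j => by fun_prop
  have hcomp := integral_comp_smoothMinMax_le hβ hδ hτ hτ_inv hg hg_nonneg hg_le hX_meas hX'_meas
    hX₁ hX'₁ hX₃ hX'₃
  have hint := integrable_comp_smoothMinMax (P := P) β δ τ hg.continuous hg_nonneg hg_le hX_meas
  have hint' := integrable_comp_smoothMinMax (P := P) β δ τ hg.continuous hg_nonneg hg_le hX'_meas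
  have hleft : P {ω | (⨅ i, ⨆ j, X ω i j) ∈ A}
      ≤ ENNReal.ofReal (∫ ω, g (τ⁻¹ * smoothMinMax β δ (X ω)) ∂P) := by
    rw [ofReal_integral_eq_lintegral_ofReal hint
      (Filter.Eventually.of_forall fun ω => hg_nonneg _)]
    refine (measure_mono fun ω hω => ?_).trans
      ((one_mul _).symm.trans_le (mul_meas_ge_le_lintegral₀
        hint.aestronglyMeasurable.aemeasurable.ennreal_ofReal 1))
    simp only [Set.mem_ofPred_eq] at hω ⊢
    simp [hone _ hω]
  have hright : ENNReal.ofReal (∫ ω, g (τ⁻¹ * smoothMinMax β δ (X' ω)) ∂P)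
      ≤ P {ω | (⨅ i, ⨆ j, X' ω i j) ∈ Metric.cthickening (2 * r + 3 * τ) A} := by
    rw [ofReal_integral_eq_lintegral_ofReal hint'
      (Filter.Eventually.of_forall fun ω => hg_nonneg _)]
    refine (lintegral_mono fun ω => ?_).trans (lintegral_indicator_one_le _)
    by_cases hω : (⨅ i, ⨆ j, X' ω i j) ∈ Metric.cthickening (2 * r + 3 * τ) A
    · have hω' : ω ∈ {ω | (⨅ i, ⨆ j, X' ω i j) ∈ Metric.cthickening (2 * r + 3 * τ) A} := hω
      rw [Set.indicator_of_mem hω', Pi.one_apply, ENNReal.ofReal_le_one]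
      exact hg_le _
    · simp [hzero _ hω]
  have hα : 0 < β ^ 2 * (1 + δ) ^ 2 * τ ^ 2 - 1 := by
    rw [← mul_pow, ← mul_pow]
    nlinarith
  set α := β ^ 2 * (1 + δ) ^ 2 * τ ^ 2 - 1
  have hε₁ : √(Real.exp (-α) * (1 + α)) < 1 := by
    rw [Real.sqrt_lt' one_pos, one_pow, Real.exp_neg, inv_mul_lt_iff₀ (Real.exp_pos α),
      mul_one, add_comm]
    exact Real.add_one_lt_exp hα.ne'
  have hε₀ : 0 ≤ √(Real.exp (-α) * (1 + α)) := Real.sqrt_nonneg _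
  set ε := √(Real.exp (-α) * (1 + α))
  set B₁ := ∫ ω, ⨆ i₁, ⨆ j₁, ⨆ i₂, ⨆ j₂,
    |X ω i₁ j₁ * X ω i₂ j₂ - ∫ ω', X ω' i₁ j₁ * X ω' i₂ j₂ ∂P| ∂P
  set B₁' := ∫ ω, ⨆ i₁, ⨆ j₁, ⨆ i₂, ⨆ j₂,
    |X' ω i₁ j₁ * X' ω i₂ j₂ - ∫ ω', X' ω' i₁ j₁ * X' ω' i₂ j₂ ∂P| ∂P
  set B₃ := ⨆ i₁, ⨆ j₁, ⨆ i₂, ⨆ j₂,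
    |∫ ω, (X ω i₁ j₁ * X ω i₂ j₂ - X' ω i₁ j₁ * X' ω i₂ j₂) ∂P|
  set B₂ := ∫ ω, ⨆ i, ⨆ j, |X ω i j| ^ 3 ∂P
  set B₂' := ∫ ω, ⨆ i, ⨆ j, |X' ω i j| ^ 3 ∂P
  have hB₁ : 0 ≤ B₁ := integral_nonneg fun ω => Real.iSup_nonneg fun _ =>
    Real.iSup_nonneg fun _ => Real.iSup_nonneg fun _ => Real.iSup_nonneg fun _ => abs_nonneg _
  have hB₁' : 0 ≤ B₁' := integral_nonneg fun ω => Real.iSup_nonneg fun _ =>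
    Real.iSup_nonneg fun _ => Real.iSup_nonneg fun _ => Real.iSup_nonneg fun _ => abs_nonneg _
  have hB₃ : 0 ≤ B₃ := Real.iSup_nonneg fun _ =>
    Real.iSup_nonneg fun _ => Real.iSup_nonneg fun _ => Real.iSup_nonneg fun _ => abs_nonneg _
  have hB₂ : 0 ≤ B₂ := integral_nonneg fun ω => Real.iSup_nonneg fun _ =>
    Real.iSup_nonneg fun _ => by positivity
  have hB₂' : 0 ≤ B₂' := integral_nonneg fun ω => Real.iSup_nonneg fun _ =>
    Real.iSup_nonneg fun _ => by positivity
  refine hleft.trans ((ENNReal.ofReal_le_ofReal hcomp).trans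
    (ENNReal.ofReal_add_le.trans (add_le_add hright (ENNReal.ofReal_le_ofReal ?_))))
  rw [le_div_iff₀ (by linarith)]
  have hD : 0 ≤ 13 * C * β * (1 + δ) * τ⁻¹ * (B₃ + β * (1 + δ) * (B₂ + B₂')) := by positivity
  refine (mul_le_of_le_one_right hD (by linarith)).trans ?_
  refine le_add_of_nonneg_of_le hε₀ (mul_le_mul_of_nonneg_left ?_ (by positivity))
  linarith
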